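/- arXiv:2405.15080 — 3 statements merged into one kernel-verified Lean document; each statement's English description precedes it below -/
import Mathlib

section
/- Let g be an isometry of the Euclidean plane ℝ² (EuclideanSpace ℝ (Fin 2)), let X ⊆ ℝ² × ℝ be a closed set, and let ĝ : ℝ² × ℝ → ℝ² × ℝ be the map (x, t) ↦ (g x, t). For t ∈ ℝ write X_t = {x ∈ ℝ² | (x, t) ∈ X} for the slice of X at height t. Suppose that for every t ∈ ℝ, (g '' X_t) ∩ X_t ⊆ frontier (g '' X_t) ∩ frontier X_t (frontiers taken in ℝ²). Then (ĝ '' X) ∩ X = frontier (ĝ '' X) ∩ frontier X (frontiers taken in ℝ² × ℝ). -/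
/-- The frontier of a horizontal slice is contained in the slice of the frontier. -/
theorem frontier_slice_subset {α β : Type*} [TopologicalSpace α] [TopologicalSpace β]
    (X : Set (α × β)) (t : β) :
    frontier {x | (x, t) ∈ X} ⊆ {x | (x, t) ∈ frontier X} :=
  (Continuous.prodMk_left t).frontier_preimage_subset X


/-- If every horizontal slice of a closed set `X ⊆ ℝ² × ℝ` meets its image under a
planar isometry `g` only in common frontier points (in ℝ²), then `X` meets its
image under the extension `ĝ : (x, t) ↦ (g x, t)` exactly in the common frontier
points (in ℝ² × ℝ). -/
theorem assembly_of_slicewise_frontier_condition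
    (g : EuclideanSpace ℝ (Fin 2) ≃ᵢ EuclideanSpace ℝ (Fin 2))
    (X : Set (EuclideanSpace ℝ (Fin 2) × ℝ)) (hX : IsClosed X)
    (hslice : ∀ t : ℝ,
      (g '' {x : EuclideanSpace ℝ (Fin 2) | (x, t) ∈ X}) ∩
          {x : EuclideanSpace ℝ (Fin 2) | (x, t) ∈ X} ⊆
        frontier (g '' {x : EuclideanSpace ℝ (Fin 2) | (x, t) ∈ X}) ∩
          frontier {x : EuclideanSpace ℝ (Fin 2) | (x, t) ∈ X}) :
    ((fun p : EuclideanSpace ℝ (Fin 2) × ℝ => (g p.1, p.2)) '' X) ∩ X =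
      frontier ((fun p : EuclideanSpace ℝ (Fin 2) × ℝ => (g p.1, p.2)) '' X) ∩
        frontier X := by
  set Y := (fun p : EuclideanSpace ℝ (Fin 2) × ℝ => (g p.1, p.2)) '' X with hY
  have hYc : IsClosed Y :=
    (g.toHomeomorph.prodCongr (Homeomorph.refl ℝ)).isClosedMap X hX
  refine Set.Subset.antisymm ?_ (Set.inter_subset_inter hYc.frontier_subset hX.frontier_subset)
  rintro ⟨x, t⟩ ⟨hxY, hxX⟩
  have hYt : g '' {x | (x, t) ∈ X} = {x | (x, t) ∈ Y} := by
    ext y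
    simp [hY]
  have hx := hslice t
  rw [hYt] at hx
  obtain ⟨hfY, hfX⟩ := hx ⟨hxY, hxX⟩
  exact ⟨frontier_slice_subset Y t hfY, frontier_slice_subset X t hfX⟩
end

section
/- Let n, m ≥ 1. The map sending a valid Truchet tiling σ : Fin n × Fin m → ZMod 4 to the pair of boundary colourings ((i ↦ col (σ (i, 0)) 0), (j ↦ col (σ (0, j)) 3)) ∈ (Fin n → Bool) × (Fin m → Bool) is a bijection from the set of valid Truchet tilings of the n×m grid onto (Fin n → Bool) × (Fin m → Bool). -/
/-- Side `s` of a Truchet cell with orientation `r` is black iff `s = r` or `s = r + 1`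
(sides: `0` = top, `1` = right, `2` = bottom, `3` = left). -/
def truchetCol (r s : ZMod 4) : Bool := decide (s = r ∨ s = r + 1)

/-- A Truchet configuration is a valid tiling if adjacent cells meet at differently
coloured sides. -/
def TruchetValid (n m : ℕ) (σ : Fin n × Fin m → ZMod 4) : Prop :=
  (∀ (i i' : Fin n) (j : Fin m), (i' : ℕ) = (i : ℕ) + 1 →
      truchetCol (σ (i, j)) 1 ≠ truchetCol (σ (i', j)) 3) ∧
  (∀ (i : Fin n) (j j' : Fin m), (j' : ℕ) = (j : ℕ) + 1 →
      truchetCol (σ (i, j)) 2 ≠ truchetCol (σ (i, j')) 0)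

theorem truchetCol_one (r : ZMod 4) : truchetCol r 1 = !truchetCol r 3 := by
  revert r; decide

theorem truchetCol_two (r : ZMod 4) : truchetCol r 2 = !truchetCol r 0 := by
  revert r; decide

/-- An orientation is determined by the colours of its top and left sides. -/
theorem truchetCol_zero_three_injective {r s : ZMod 4}
    (h₀ : truchetCol r 0 = truchetCol s 0) (h₃ : truchetCol r 3 = truchetCol s 3) : r = s := by
  revert r s; decide

/-- Any two colours can be prescribed for the top and left sides of a cell. -/
theorem exists_truchetCol_zero_three (a b : Bool) :
    ∃ r : ZMod 4, truchetCol r 0 = a ∧ truchetCol r 3 = b := by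
  revert a b; decide

/-- A function on `Fin n` whose consecutive values agree is constant. -/
theorem Fin.eq_zero_of_forall_succ_eq {α : Type*} {n : ℕ} (hn : 0 < n) (f : Fin n → α)
    (h : ∀ i i' : Fin n, (i' : ℕ) = (i : ℕ) + 1 → f i = f i') (i : Fin n) :
    f i = f ⟨0, hn⟩ := by
  obtain ⟨k, hk⟩ := i
  induction k with
  | zero => rfl
  | succ k ih => exact (h ⟨k, by omega⟩ ⟨k + 1, hk⟩ rfl).symm.trans (ih _)

/-- Since opposite sides of a cell have opposite colours, a configuration is a valid tiling iff
left colours are constant along rows and top colours are constant along columns. -/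
theorem truchetValid_iff {n m : ℕ} (hn : 0 < n) (hm : 0 < m) (σ : Fin n × Fin m → ZMod 4) :
    TruchetValid n m σ ↔
      (∀ i j, truchetCol (σ (i, j)) 3 = truchetCol (σ (⟨0, hn⟩, j)) 3) ∧
      (∀ i j, truchetCol (σ (i, j)) 0 = truchetCol (σ (i, ⟨0, hm⟩)) 0) := by
  simp only [TruchetValid, truchetCol_one, truchetCol_two, ne_eq, Bool.not_eq_not,
    Bool.not_eq_eq_eq_not]
  constructor
  · rintro ⟨h₃, h₀⟩
    exact ⟨fun i j => Fin.eq_zero_of_forall_succ_eq hn (fun i => truchetCol (σ (i, j)) 3)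
        (fun i i' => h₃ i i' j) i,
      fun i j => Fin.eq_zero_of_forall_succ_eq hm (fun j => truchetCol (σ (i, j)) 0) (h₀ i) j⟩
  · rintro ⟨h₃, h₀⟩
    exact ⟨fun i i' j _ => (h₃ i j).trans (h₃ i' j).symm,
      fun i j j' _ => (h₀ i j).trans (h₀ i j').symm⟩

/-- A valid Truchet tiling of the `n × m` grid is uniquely determined by, and can be
reconstructed from, the colours of its upper and left boundary: taking the boundary
colourings is a bijection onto `(Fin n → Bool) × (Fin m → Bool)`. -/
theorem truchet_boundary_bijective (n m : ℕ) (hn : 1 ≤ n) (hm : 1 ≤ m) :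
    Function.Bijective
      (fun σ : {σ : Fin n × Fin m → ZMod 4 // TruchetValid n m σ} =>
        ((fun i : Fin n => truchetCol (σ.1 (i, ⟨0, hm⟩)) 0),
         (fun j : Fin m => truchetCol (σ.1 (⟨0, hn⟩, j)) 3)) :
        {σ : Fin n × Fin m → ZMod 4 // TruchetValid n m σ} →
          (Fin n → Bool) × (Fin m → Bool)) := by
  constructor
  · rintro ⟨σ, hσ⟩ ⟨τ, hτ⟩ h
    obtain ⟨hσ₃, hσ₀⟩ := (truchetValid_iff hn hm σ).1 hσ
    obtain ⟨hτ₃, hτ₀⟩ := (truchetValid_iff hn hm τ).1 hτ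
    obtain ⟨h₀, h₃⟩ := Prod.mk.inj h
    refine Subtype.ext (funext fun ⟨i, j⟩ => truchetCol_zero_three_injective ?_ ?_)
    · exact (hσ₀ i j).trans ((congrFun h₀ i).trans (hτ₀ i j).symm)
    · exact (hσ₃ i j).trans ((congrFun h₃ j).trans (hτ₃ i j).symm)
  · rintro ⟨a, b⟩
    choose c hc₀ hc₃ using exists_truchetCol_zero_three
    refine ⟨⟨fun p => c (a p.1) (b p.2), (truchetValid_iff hn hm _).2 ?_⟩, ?_⟩
    · simp [hc₀, hc₃]
    · simp [hc₀, hc₃]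
end

section
/- Let a, b, c ≥ 1 be natural numbers, and let P be the number of functions f : Fin a × Fin b → ℕ such that f(i,j) ≤ c for all (i,j), and f is weakly decreasing in each coordinate (if i ≤ i' then f(i',j) ≤ f(i,j), and if j ≤ j' then f(i,j') ≤ f(i,j)). Then, as rational numbers, P = ∏_{i=1}^{a} ∏_{j=1}^{b} ∏_{k=1}^{c} (i+j+k−1)/(i+j+k−2). -/
open Finset

/-- The weakly decreasing `n`-tuples of naturals lying below `l`. -/
noncomputable def antitoneTuples {n : ℕ} (l : Fin n → ℕ) : Finset (Fin n → ℕ) :=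
  open Classical in {m ∈ Iic l | Antitone m}

theorem mem_antitoneTuples {n : ℕ} {l m : Fin n → ℕ} :
    m ∈ antitoneTuples l ↔ m ≤ l ∧ Antitone m := by
  simp [antitoneTuples]

theorem antitone_cons_iff {α : Type*} [Preorder α] {n : ℕ} {x : α} {g : Fin n → α} :
    Antitone (Fin.cons x g : Fin (n + 1) → α) ↔ (∀ i, g i ≤ x) ∧ Antitone g := by
  constructor
  · intro h
    refine ⟨fun i => ?_, fun i j hij => ?_⟩
    · simpa using h (Fin.zero_le i.succ)
    · simpa using h (Fin.succ_le_succ_iff.2 hij)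
  · rintro ⟨h₀, h⟩ i j hij
    induction i using Fin.cases with
    | zero =>
      induction j using Fin.cases with
      | zero => exact le_rfl
      | succ j => simpa using h₀ j
    | succ i =>
      induction j using Fin.cases with
      | zero => simp at hij
      | succ j => simpa using h (Fin.succ_le_succ_iff.1 hij)

theorem sum_antitoneTuples_succ {M : Type*} [AddCommMonoid M] {n : ℕ} (l : Fin (n + 1) → ℕ)
    (f : (Fin (n + 1) → ℕ) → M) :
    ∑ m ∈ antitoneTuples l, f m =
      ∑ m ∈ antitoneTuples (Fin.tail l), ∑ t ∈ Icc (univ.sup m) (l 0), f (Fin.cons t m) := by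
  rw [Finset.sum_sigma']
  refine Finset.sum_bij' (fun m _ => ⟨Fin.tail m, m 0⟩) (fun p _ => Fin.cons p.2 p.1) ?_ ?_ ?_ ?_ ?_
  · intro m hm
    rw [mem_antitoneTuples] at hm
    simp only [mem_sigma, mem_antitoneTuples, mem_Icc, Finset.sup_le_iff]
    exact ⟨⟨fun i => hm.1 _, fun i j hij => hm.2 (Fin.succ_le_succ_iff.2 hij)⟩,
      fun i _ => hm.2 (Fin.zero_le _), hm.1 0⟩
  · rintro ⟨m, t⟩ hp
    simp only [mem_sigma, mem_antitoneTuples, mem_Icc, Finset.sup_le_iff] at hp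
    rw [mem_antitoneTuples, antitone_cons_iff]
    refine ⟨fun i => ?_, fun i => hp.2.1 i (mem_univ _), hp.1.2⟩
    induction i using Fin.cases with
    | zero => exact hp.2.2
    | succ i => exact hp.1.1 i
  · intro m _
    exact Fin.cons_self_tail m
  · rintro ⟨m, t⟩ _
    simp
  · intro m _
    simp [Fin.cons_self_tail]

/-- Summing an alternating map over weakly decreasing tuples telescopes in each argument. -/
theorem sum_antitoneTuples_alternatingMap {R V W : Type*} [CommRing R] [AddCommGroup V] [Module R V]
    [AddCommGroup W] [Module R W] {n : ℕ} (A : V [⋀^Fin n]→ₗ[R] W) (u : ℕ → ℕ → V)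
    (hu : ∀ i t, u (i + 1) (t + 1) = u (i + 1) t + u i t) (h0 : u n 0 = 0)
    (l : Fin n → ℕ) (hl : Antitone l) :
    ∑ m ∈ antitoneTuples l, A (fun i => u i (m i)) = A (fun i => u (i + 1) (l i + 1)) := by
  induction n generalizing u with
  | zero =>
    have : antitoneTuples l = {l} := by
      ext m
      simp [mem_antitoneTuples, Subsingleton.elim m l, hl]
    rw [this, sum_singleton]
    exact congrArg A (Subsingleton.elim _ _)
  | succ n ih =>
    have hsum (i : ℕ) {p q : ℕ} (hpq : p ≤ q) :
        ∑ t ∈ Icc p q, u i t = u (i + 1) (q + 1) - u (i + 1) p := by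
      induction q, hpq using Nat.le_induction with
      | base => simp [hu]
      | succ q hpq ihq =>
        rw [sum_Icc_succ_top (by omega), ihq, hu _ (q + 1)]
        abel
    have htail : Antitone (Fin.tail l) := fun i j hij => hl (Fin.succ_le_succ_iff.2 hij)
    have key : ∀ m ∈ antitoneTuples (Fin.tail l),
        ∑ t ∈ Icc (univ.sup m) (l 0), A (fun i => u i ((Fin.cons t m : Fin (n + 1) → ℕ) i)) =
          A.curryLeft (u 1 (l 0 + 1)) (fun i => u (i + 1) (m i)) := by
      intro m hm
      rw [mem_antitoneTuples] at hm
      have hle : univ.sup m ≤ l 0 :=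
        Finset.sup_le fun i _ => (hm.1 i).trans (hl (Fin.zero_le _))
      have hrow (t : ℕ) : A (fun i => u i ((Fin.cons t m : Fin (n + 1) → ℕ) i)) =
          A.curryLeft (u 0 t) (fun i => u (i + 1) (m i)) := by
        rw [AlternatingMap.curryLeft_apply_apply]
        congr 1
        ext i
        induction i using Fin.cases <;> simp [Matrix.vecCons]
      have hvanish : A.curryLeft (u 1 (univ.sup m)) (fun i => u (i + 1) (m i)) = 0 := by
        cases n with
        | zero => simp [h0]
        | succ n =>
          have : univ.sup m = m 0 :=
            le_antisymm (Finset.sup_le fun i _ => hm.2 (Fin.zero_le i)) (le_sup (mem_univ 0))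
          rw [this, AlternatingMap.curryLeft_apply_apply]
          exact A.map_eq_zero_of_eq _ (i := 0) (j := 1) (by simp [Matrix.vecCons]) (by simp)
      let φ : V →+ W := AddMonoidHom.mk' (fun x => A.curryLeft x (fun i => u (i + 1) (m i)))
        fun x y => by rw [map_add, AlternatingMap.add_apply]
      calc _ = ∑ t ∈ Icc (univ.sup m) (l 0), φ (u 0 t) := sum_congr rfl fun t _ => hrow t
        _ = φ (u 1 (l 0 + 1)) - φ (u 1 (univ.sup m)) := by rw [← map_sum, hsum 0 hle, map_sub]
        _ = _ := (congrArg _ hvanish).trans (sub_zero _)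
    rw [sum_antitoneTuples_succ, sum_congr rfl key,
      ih (A.curryLeft (u 1 (l 0 + 1))) (fun i => u (i + 1)) (fun i => hu (i + 1)) h0 _ htail,
      AlternatingMap.curryLeft_apply_apply]
    congr 1
    ext i
    induction i using Fin.cases <;> simp [Matrix.vecCons, Fin.tail]

/-- The matrix whose determinant counts the `a × b` plane partitions with columns below `l`. -/
def boundedColumnMatrix {a : ℕ} (b : ℕ) (l : Fin a → ℕ) : Matrix (Fin a) (Fin a) ℚ :=
  Matrix.of fun i j => ((l i + b + j).choose (b + i) : ℚ)

theorem det_boundedColumnMatrix_zero {a : ℕ} (l : Fin a → ℕ) :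
    (boundedColumnMatrix 0 l).det = 1 := by
  let L : Matrix (Fin a) (Fin a) ℚ :=
    Matrix.of fun i k => if k ≤ i then ((l i).choose (i - k) : ℚ) else 0
  let U : Matrix (Fin a) (Fin a) ℚ := Matrix.of fun k j => ((j : ℕ).choose k : ℚ)
  have hLU : boundedColumnMatrix 0 l = L * U := by
    ext i j
    simp only [boundedColumnMatrix, L, U, Matrix.mul_apply, Matrix.of_apply]
    rw [add_zero, zero_add, Nat.add_comm, Nat.add_choose_eq,
      Nat.sum_antidiagonal_eq_sum_range_succ_mk]
    simp_rw [Fin.le_def]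
    rw [Fin.sum_univ_eq_sum_range (fun k =>
      (if k ≤ (i : ℕ) then ((l i).choose (i - k) : ℚ) else 0) * ((j : ℕ).choose k : ℚ)) a]
    push_cast
    rw [← Finset.sum_subset (Finset.range_subset_range.2 (Nat.succ_le_of_lt i.2))]
    · refine sum_congr rfl fun k hk => ?_
      rw [if_pos (by simpa [Nat.lt_succ_iff] using hk), mul_comm]
    · intro k _ hk
      rw [if_neg (by simpa [Nat.lt_succ_iff] using hk), zero_mul]
  have hL : L.det = 1 := by
    rw [Matrix.det_of_isLowerTriangular]
    · simp [L]
    · intro i j hij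
      have : i < j := hij
      simp [L, this]
  have hU : U.det = 1 := by
    rw [Matrix.det_of_isUpperTriangular]
    · simp [U]
    · intro i j hij
      have : j < i := hij
      simp [U, Nat.choose_eq_zero_of_lt this]
  rw [hLU, Matrix.det_mul, hL, hU, one_mul]

theorem sum_det_boundedColumnMatrix {a : ℕ} (b : ℕ) {l : Fin a → ℕ} (hl : Antitone l) :
    ∑ m ∈ antitoneTuples l, (boundedColumnMatrix b m).det =
      (boundedColumnMatrix (b + 1) l).det := by
  have := sum_antitoneTuples_alternatingMap (R := ℚ) (Matrix.detRowAlternating (n := Fin a))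
    (fun i t j => ((t + b + j).choose (b + i) : ℚ)) ?_ ?_ l hl
  · refine this.trans (congrArg (Matrix.detRowAlternating (n := Fin a) (R := ℚ)) ?_)
    ext i j
    simp only [boundedColumnMatrix, Matrix.of_apply]
    congr 2 <;> ring
  · intro i t
    ext j
    simp only [Pi.add_apply]
    rw [show t + 1 + b + j = t + b + j + 1 by ring, ← add_assoc, Nat.choose_succ_succ]
    push_cast
    ring
  · ext j
    simp only [Pi.zero_apply]
    rw [Nat.choose_eq_zero_of_lt (by omega), Nat.cast_zero]

/-- Sequences of `b` weakly decreasing `a`-tuples, themselves weakly decreasing and below `l`. -/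
noncomputable def columnSequences {a : ℕ} (b : ℕ) (l : Fin a → ℕ) : Finset (Fin b → Fin a → ℕ) :=
  open Classical in {g ∈ Iic (fun _ => l) | Antitone g ∧ ∀ j, Antitone (g j)}

theorem mem_columnSequences {a b : ℕ} {l : Fin a → ℕ} {g : Fin b → Fin a → ℕ} :
    g ∈ columnSequences b l ↔ (∀ j, g j ≤ l) ∧ Antitone g ∧ ∀ j, Antitone (g j) := by
  simp only [columnSequences, mem_filter, mem_Iic]
  rfl

theorem card_columnSequences_succ {a : ℕ} (b : ℕ) (l : Fin a → ℕ) :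
    #(columnSequences (b + 1) l) = ∑ m ∈ antitoneTuples l, #(columnSequences b m) := by
  rw [← Finset.card_sigma]
  refine Finset.card_bij' (fun g _ => ⟨g 0, Fin.tail g⟩) (fun p _ => Fin.cons p.1 p.2) ?_ ?_ ?_ ?_
  · intro g hg
    rw [mem_columnSequences] at hg
    simp only [mem_sigma, mem_antitoneTuples, mem_columnSequences]
    exact ⟨⟨hg.1 0, hg.2.2 0⟩, fun j => hg.2.1 (Fin.zero_le _),
      fun i j hij => hg.2.1 (Fin.succ_le_succ_iff.2 hij), fun j => hg.2.2 _⟩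
  · rintro ⟨m, g⟩ hp
    simp only [mem_sigma, mem_antitoneTuples, mem_columnSequences] at hp
    rw [mem_columnSequences, antitone_cons_iff]
    refine ⟨fun j => ?_, ⟨hp.2.1, hp.2.2.1⟩, fun j => ?_⟩
    · induction j using Fin.cases with
      | zero => exact hp.1.1
      | succ j => exact (hp.2.1 j).trans hp.1.1
    · induction j using Fin.cases with
      | zero => exact hp.1.2
      | succ j => exact hp.2.2.2 j
  · intro g _
    exact Fin.cons_self_tail g
  · rintro ⟨m, g⟩ _
    simp

theorem card_columnSequences {a : ℕ} (b : ℕ) {l : Fin a → ℕ} (hl : Antitone l) :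
    (#(columnSequences b l) : ℚ) = (boundedColumnMatrix b l).det := by
  induction b generalizing l with
  | zero =>
    have : columnSequences 0 l = univ := by
      ext g
      simp only [mem_columnSequences, mem_univ, iff_true]
      exact ⟨fun j => j.elim0, fun j => j.elim0, fun j => j.elim0⟩
    simp [this, det_boundedColumnMatrix_zero]
  | succ b ih =>
    rw [card_columnSequences_succ, Nat.cast_sum, ← sum_det_boundedColumnMatrix b hl]
    exact sum_congr rfl fun m hm => ih (mem_antitoneTuples.1 hm).2

theorem cast_add_choose_add (b n i : ℕ) :
    ((b + n).choose (b + i) : ℚ) =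
      ((i.factorial : ℚ) / (b + i).factorial) *
        (((b + n).factorial : ℚ) / n.factorial * (n.choose i : ℚ)) := by
  rcases le_or_gt i n with h | h
  · rw [Nat.cast_choose ℚ h, Nat.cast_choose ℚ (Nat.add_le_add_left h b), Nat.add_sub_add_left]
    field_simp
  · simp [Nat.choose_eq_zero_of_lt h, Nat.choose_eq_zero_of_lt (Nat.add_lt_add_left h b)]

theorem det_boundedColumnMatrix_const (a b c : ℕ) :
    (boundedColumnMatrix b fun _ : Fin a => c).det =
      ∏ i ∈ range a, ((i.factorial : ℚ) / (b + i).factorial) *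
        (((b + (c + i)).factorial : ℚ) / (c + i).factorial) := by
  have h : (boundedColumnMatrix b fun _ : Fin a => c) =
      Matrix.of fun i j : Fin a => (((i : ℕ).factorial : ℚ) / (b + i).factorial) *
        Matrix.of (fun i j : Fin a => (((b + (c + j)).factorial : ℚ) / (c + j).factorial) *
          boundedColumnMatrix 0 (fun _ : Fin a => c) i j) i j := by
    ext i j
    simp only [boundedColumnMatrix, Matrix.of_apply, add_zero, zero_add]
    rw [← cast_add_choose_add, ← add_assoc, Nat.add_comm c b]
  rw [h, Matrix.det_mul_column, Matrix.det_mul_row, det_boundedColumnMatrix_zero, mul_one,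
    ← prod_mul_distrib]
  exact Fin.prod_univ_eq_prod_range (fun i => ((i.factorial : ℚ) / (b + i).factorial) *
        (((b + (c + i)).factorial : ℚ) / (c + i).factorial)) a

theorem prod_Icc_div_telescope (i j : ℕ) (hi : 1 ≤ i) (hj : 1 ≤ j) (c : ℕ) :
    ∏ k ∈ Icc 1 c, ((i : ℚ) + j + k - 1) / ((i : ℚ) + j + k - 2) =
      ((i : ℚ) + j + c - 1) / ((i : ℚ) + j - 1) := by
  have hi' : (1 : ℚ) ≤ i := by exact_mod_cast hi
  have hj' : (1 : ℚ) ≤ j := by exact_mod_cast hj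
  induction c with
  | zero => simp [div_self (show (i : ℚ) + j - 1 ≠ 0 by linarith)]
  | succ c ih =>
    have hc : (0 : ℚ) ≤ c := c.cast_nonneg
    rw [prod_Icc_succ_top (by omega), ih]
    push_cast
    rw [show (i : ℚ) + j + (c + 1) - 2 = i + j + c - 1 by ring, mul_comm,
      div_mul_div_cancel₀ (by linarith)]

theorem prod_Icc_prod_Icc_div (i : ℕ) (b c : ℕ) :
    ∏ j ∈ Icc 1 b, ∏ k ∈ Icc 1 c,
        (((i + 1 : ℕ) : ℚ) + j + k - 1) / (((i + 1 : ℕ) : ℚ) + j + k - 2) =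
      ((i.factorial : ℚ) / (b + i).factorial) *
        (((b + (c + i)).factorial : ℚ) / (c + i).factorial) := by
  induction b with
  | zero =>
    simp [div_self (Nat.cast_ne_zero.2 (Nat.factorial_ne_zero _) : ((_ : ℕ) : ℚ) ≠ 0)]
  | succ b ih =>
    rw [prod_Icc_succ_top (by omega), ih, prod_Icc_div_telescope _ _ (by omega) (by omega),
      show b + 1 + i = b + i + 1 by ring, show b + 1 + (c + i) = b + (c + i) + 1 by ring,
      Nat.factorial_succ, Nat.factorial_succ]
    push_cast
    rw [show (i : ℚ) + 1 + (b + 1) + c - 1 = b + (c + i) + 1 by ring,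
      show (i : ℚ) + 1 + (b + 1) - 1 = b + i + 1 by ring]
    have : (b : ℚ) + i + 1 ≠ 0 := by positivity
    field_simp

/-- Plane partitions in an `a × b × c` box, read column by column. -/
noncomputable def planePartitionEquiv (a b c : ℕ) :
    {f : Fin a × Fin b → ℕ //
        (∀ p : Fin a × Fin b, f p ≤ c) ∧
        (∀ (i i' : Fin a) (j : Fin b), i ≤ i' → f (i', j) ≤ f (i, j)) ∧
        (∀ (i : Fin a) (j j' : Fin b), j ≤ j' → f (i, j') ≤ f (i, j))} ≃
      columnSequences b (fun _ : Fin a => c) where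
  toFun f := ⟨fun j i => f.1 (i, j), mem_columnSequences.2
    ⟨fun j i => f.2.1 (i, j), fun j j' h i => f.2.2.2 i j j' h, fun j i i' h => f.2.2.1 i i' j h⟩⟩
  invFun g := ⟨fun p => g.1 p.2 p.1, by
    have hg := mem_columnSequences.1 g.2
    exact ⟨fun p => hg.1 p.2 p.1, fun i i' j h => hg.2.2 j h, fun i j j' h => hg.2.1 h i⟩⟩
  left_inv _ := rfl
  right_inv _ := rfl


/-- MacMahon's formula: the number of plane partitions in an `a × b × c` box
(equivalently, lozenge tilings of the hexagon with side lengths `a`, `b`, `c`)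
is `∏_{i=1}^{a} ∏_{j=1}^{b} ∏_{k=1}^{c} (i+j+k-1)/(i+j+k-2)`. -/
theorem macmahon_plane_partitions (a b c : ℕ) (ha : 1 ≤ a) (hb : 1 ≤ b) (hc : 1 ≤ c) :
    (Nat.card {f : Fin a × Fin b → ℕ //
        (∀ p : Fin a × Fin b, f p ≤ c) ∧
        (∀ (i i' : Fin a) (j : Fin b), i ≤ i' → f (i', j) ≤ f (i, j)) ∧
        (∀ (i : Fin a) (j j' : Fin b), j ≤ j' → f (i, j') ≤ f (i, j))} : ℚ) =
      ∏ i ∈ Finset.Icc 1 a, ∏ j ∈ Finset.Icc 1 b, ∏ k ∈ Finset.Icc 1 c,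
        ((i : ℚ) + j + k - 1) / ((i : ℚ) + j + k - 2) := by
  rw [Nat.card_congr (planePartitionEquiv a b c), Nat.card_eq_fintype_card, Fintype.card_coe,
    card_columnSequences b antitone_const, det_boundedColumnMatrix_const,
    ← Ico_add_one_right_eq_Icc, prod_Ico_eq_prod_range]
  refine prod_congr rfl fun i _ => ?_
  rw [Nat.add_comm 1 i, prod_Icc_prod_Icc_div]
end
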